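/- For every n ≥ 1 there exists a finite collection 𝒞_n of pairwise disjoint subsets of X whose union is X, each element of 𝒞_n being the set of x ∈ X satisfying finitely many linear inequalities (each either strict, a·x < b, or weak, a·x ≤ b, with a ∈ ℝ^N, b ∈ ℝ), such that for every integer s and every C ∈ 𝒞_n there exists γ ∈ ℝ^N with v^U_n(x,s) = x·γ for all x ∈ C. Moreover 𝒞_{n+1} refines 𝒞_n: every element of 𝒞_{n+1} is contained in some element of 𝒞_n. -/

import Mathlib

open Finset

noncomputable section

open scoped Classical

namespace InvCtrl

variable {N M : ℕ} {Z : Type*}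

/-- Membership in the belief space `X ⊆ ℝ^N`. -/
def memX (N : ℕ) (x : Fin N → ℝ) : Prop :=
  (∀ i, 0 ≤ x i) ∧ ∑ i, x i = 1

variable [Fintype Z]

/-- `σ(d_k, z, x) = x ⬝ P(d_k, z) ⬝ 𝟙`. -/
def sigz (P : Fin M → Z → Matrix (Fin N) (Fin N) ℝ) (k : Fin M) (z : Z) (x : Fin N → ℝ) : ℝ :=
  ∑ i, x i * ∑ j, P k z i j

/-- `σ(d_k, x) = ∑_z σ(d_k, z, x)`. -/
def sig (P : Fin M → Z → Matrix (Fin N) (Fin N) ℝ) (k : Fin M) (x : Fin N → ℝ) : ℝ :=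
  ∑ z, sigz P k z x

/-- Posterior belief `λ(d_k, z, x) = x P(d_k, z) / σ(d_k, z, x)` (componentwise). -/
def lam (P : Fin M → Z → Matrix (Fin N) (Fin N) ℝ) (k : Fin M) (z : Z) (x : Fin N → ℝ) :
    Fin N → ℝ :=
  fun j => (∑ i, x i * P k z i j) / sigz P k z x

/-- Single-period cost `c(y, d) = p·(d − y)⁺ + h·(y − d)⁺`. -/
def cst (p hc y dd : ℝ) : ℝ := p * max (dd - y) 0 + hc * max (y - dd) 0

/-- Expected single-period cost `L(x, y) = ∑_k σ(d_k, x) c(y, d_k)`. -/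
def Lf (P : Fin M → Z → Matrix (Fin N) (Fin N) ℝ) (d : Fin M → ℤ) (p hc : ℝ)
    (x : Fin N → ℝ) (y : ℝ) : ℝ :=
  ∑ k, sig P k x * cst p hc y (d k : ℝ)

/-- `s*(x)`: the smallest element of `{d_1, …, d_M}` at which `m ↦ L(x, d_m)` is minimized. -/
def sStar (P : Fin M → Z → Matrix (Fin N) (Fin N) ℝ) (d : Fin M → ℤ) (p hc : ℝ)
    (x : Fin N → ℝ) : ℤ :=
  sInf {t : ℤ | ∃ m : Fin M, t = d m ∧ ∀ k : Fin M, Lf P d p hc x (d m : ℝ) ≤ Lf P d p hc x (d k : ℝ)}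

/-- First-order stochastic dominance `x ⪯ x'`. -/
def sdom (x x' : Fin N → ℝ) : Prop :=
  ∀ n : Fin N, ∑ i ∈ univ.filter (fun i => n ≤ i), x i ≤ ∑ i ∈ univ.filter (fun i => n ≤ i), x' i

/-- The `i`-th standard unit vector in `ℝ^N`. -/
def eV (N : ℕ) (i : Fin N) : Fin N → ℝ := fun j => if j = i then 1 else 0

/-- Assumption A3. -/
def A3 (P : Fin M → Z → Matrix (Fin N) (Fin N) ℝ) : Prop :=
  ∀ i i' : Fin N, i ≤ i' → ∀ m : Fin M,
    ∑ k ∈ univ.filter (fun k : Fin M => m ≤ k), ∑ j, ∑ z, P k z i j ≤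
      ∑ k ∈ univ.filter (fun k : Fin M => m ≤ k), ∑ j, ∑ z, P k z i' j

/-- `A_m(x) = h ∑_{k=1}^m σ(d_k,x) − p ∑_{k=m+1}^M σ(d_k,x)` (for `m = 0, …, M`). -/
def Am (P : Fin M → Z → Matrix (Fin N) (Fin N) ℝ) (p hc : ℝ) (m : ℕ) (x : Fin N → ℝ) : ℝ :=
  hc * ∑ k ∈ univ.filter (fun k : Fin M => (k : ℕ) < m), sig P k x
    - p * ∑ k ∈ univ.filter (fun k : Fin M => m ≤ (k : ℕ)), sig P k x

/-- `B_m(x) = p ∑_{k=m+1}^M d_k σ(d_k,x) − h ∑_{k=1}^m d_k σ(d_k,x)` (for `m = 0, …, M`). -/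
def Bm (P : Fin M → Z → Matrix (Fin N) (Fin N) ℝ) (d : Fin M → ℤ) (p hc : ℝ) (m : ℕ)
    (x : Fin N → ℝ) : ℝ :=
  p * ∑ k ∈ univ.filter (fun k : Fin M => m ≤ (k : ℕ)), (d k : ℝ) * sig P k x
    - hc * ∑ k ∈ univ.filter (fun k : Fin M => (k : ℕ) < m), (d k : ℝ) * sig P k x

/-- Finite-horizon value iteration: `v_0 = 0` and
`v_{n+1}(x,s) = inf_{y ≥ s, y ∈ ℤ} [ L(x,y) + β ∑_{(d_k,z) : σ(d_k,z,x) ≠ 0} σ(d_k,z,x)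
v_n(λ(d_k,z,x), f(y,d_k)) ]`, for a general transition `f` of the inventory position. -/
def vIter (P : Fin M → Z → Matrix (Fin N) (Fin N) ℝ) (d : Fin M → ℤ) (p hc β : ℝ)
    (f : ℤ → ℤ → ℤ) : ℕ → (Fin N → ℝ) → ℤ → ℝ
  | 0, _, _ => 0
  | n + 1, x, s =>
    sInf {r : ℝ | ∃ y : ℤ, s ≤ y ∧
      r = Lf P d p hc x (y : ℝ) + β * ∑ k, ∑ z,
        (if sigz P k z x = 0 then 0
         else sigz P k z x * vIter P d p hc β f n (lam P k z x) (f y (d k)))}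

/-- The lower-bound iteration: `v^L_0 = 0` and
`v^L_{n+1}(x) = L(x, s*(x)) + β ∑_{(d_k,z) : σ ≠ 0} σ(d_k,z,x) v^L_n(λ(d_k,z,x))`. -/
def vLow (P : Fin M → Z → Matrix (Fin N) (Fin N) ℝ) (d : Fin M → ℤ) (p hc β : ℝ) :
    ℕ → (Fin N → ℝ) → ℝ
  | 0, _ => 0
  | n + 1, x =>
    Lf P d p hc x ((sStar P d p hc x : ℤ) : ℝ) + β * ∑ k, ∑ z,
      (if sigz P k z x = 0 then 0
       else sigz P k z x * vLow P d p hc β n (lam P k z x))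

/-- The upper-bound iteration (cost of the myopic "order up to `max{s*(x),s}`" policy):
`v^U_0 = 0` and, with `y(x,s) = max{s*(x),s}`,
`v^U_{n+1}(x,s) = L(x,y(x,s)) + β ∑_{(d_k,z) : σ ≠ 0} σ(d_k,z,x)
v^U_n(λ(d_k,z,x), y(x,s) − d_k)`. -/
def vUp (P : Fin M → Z → Matrix (Fin N) (Fin N) ℝ) (d : Fin M → ℤ) (p hc β : ℝ) :
    ℕ → (Fin N → ℝ) → ℤ → ℝ
  | 0, _, _ => 0
  | n + 1, x, s =>
    Lf P d p hc x ((max (sStar P d p hc x) s : ℤ) : ℝ) + β * ∑ k, ∑ z,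
      (if sigz P k z x = 0 then 0
       else sigz P k z x * vUp P d p hc β n (lam P k z x) (max (sStar P d p hc x) s - d k))


/-- Inner product. -/
def ip (x a : Fin N → ℝ) : ℝ := ∑ i, x i * a i

/-- Pullback of a functional along `x ↦ x P`. -/
def pull (A : Matrix (Fin N) (Fin N) ℝ) (a : Fin N → ℝ) : Fin N → ℝ := fun i => ∑ j, A i j * a j

/-- Sign cell of `x0`. -/
def cell (F : Finset (Fin N → ℝ)) (x0 : Fin N → ℝ) : Set (Fin N → ℝ) :=
  {x | memX N x ∧ ∀ a ∈ F, SignType.sign (ip x a) = SignType.sign (ip x0 a)}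

/-- Linear on a set. -/
def LinOn (S : Set (Fin N → ℝ)) (f : (Fin N → ℝ) → ℝ) : Prop :=
  ∃ γ : Fin N → ℝ, ∀ x ∈ S, f x = ∑ i, x i * γ i

/-- Polyhedral subsets of the belief space. -/
def Poly (S : Set (Fin N → ℝ)) : Prop :=
  ∃ (ks kw : ℕ) (a : Fin ks → Fin N → ℝ) (b : Fin ks → ℝ)
            (a' : Fin kw → Fin N → ℝ) (b' : Fin kw → ℝ),
          S = {x : Fin N → ℝ | memX N x ∧ (∀ i, ∑ j, a i j * x j < b i) ∧
            (∀ i, ∑ j, a' i j * x j ≤ b' i)}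

lemma LinOn.add {S : Set (Fin N → ℝ)} {f g : (Fin N → ℝ) → ℝ} (hf : LinOn S f) (hg : LinOn S g) :
    LinOn S (fun x => f x + g x) := by
  obtain ⟨u, hu⟩ := hf
  obtain ⟨w, hw⟩ := hg
  refine ⟨fun i => u i + w i, fun x hx => ?_⟩
  simp only [hu x hx, hw x hx, mul_add, Finset.sum_add_distrib]

lemma LinOn.smul {S : Set (Fin N → ℝ)} {f : (Fin N → ℝ) → ℝ} (c : ℝ) (hf : LinOn S f) :
    LinOn S (fun x => c * f x) := by
  obtain ⟨u, hu⟩ := hf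
  refine ⟨fun i => c * u i, fun x hx => ?_⟩
  simp only [hu x hx, Finset.mul_sum]
  exact Finset.sum_congr rfl fun i _ => by ring

lemma LinOn.zero {S : Set (Fin N → ℝ)} : LinOn S (fun _ => 0) :=
  ⟨fun _ => 0, fun x _ => by simp⟩

lemma LinOn.sum {ι : Type*} {S : Set (Fin N → ℝ)} (t : Finset ι) {f : ι → (Fin N → ℝ) → ℝ}
    (hf : ∀ k, LinOn S (f k)) : LinOn S (fun x => ∑ k ∈ t, f k x) := by
  induction t using Finset.induction_on with
  | empty => simpa using LinOn.zero
  | insert a t ha ih =>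
    simp only [Finset.sum_insert ha]
    exact (hf a).add ih

lemma LinOn.congr {S : Set (Fin N → ℝ)} {f g : (Fin N → ℝ) → ℝ} (hf : LinOn S f)
    (h : ∀ x ∈ S, g x = f x) : LinOn S g := by
  obtain ⟨u, hu⟩ := hf
  exact ⟨u, fun x hx => (h x hx).trans (hu x hx)⟩

lemma LinOn.sigz {S : Set (Fin N → ℝ)} (P : Fin M → Z → Matrix (Fin N) (Fin N) ℝ)
    (k : Fin M) (z : Z) : LinOn S (InvCtrl.sigz P k z) := ⟨_, fun _ _ => rfl⟩

lemma LinOn.Lf {S : Set (Fin N → ℝ)} (P : Fin M → Z → Matrix (Fin N) (Fin N) ℝ)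
    (d : Fin M → ℤ) (p hc y : ℝ) : LinOn S (fun x => InvCtrl.Lf P d p hc x y) := by
  unfold InvCtrl.Lf
  refine LinOn.sum _ fun k => ?_
  have : LinOn S (fun x => cst p hc y (d k) * sig P k x) :=
    LinOn.smul _ (by unfold sig; exact LinOn.sum _ fun z => LinOn.sigz P k z)
  exact this.congr fun x _ => mul_comm _ _

lemma Poly.lt {S : Set (Fin N → ℝ)} (h : Poly S) (c : Fin N → ℝ) (e : ℝ) :
    Poly (S ∩ {x | ∑ j, c j * x j < e}) := by
  obtain ⟨ks, kw, a, b, a', b', rfl⟩ := h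
  refine ⟨ks + 1, kw, Fin.cons c a, Fin.cons e b, a', b', ?_⟩
  ext x
  simp only [Set.mem_inter_iff, Set.mem_ofPred_eq, Fin.forall_fin_succ, Fin.cons_zero,
    Fin.cons_succ]
  tauto

lemma Poly.le {S : Set (Fin N → ℝ)} (h : Poly S) (c : Fin N → ℝ) (e : ℝ) :
    Poly (S ∩ {x | ∑ j, c j * x j ≤ e}) := by
  obtain ⟨ks, kw, a, b, a', b', rfl⟩ := h
  refine ⟨ks, kw + 1, a, b, Fin.cons c a', Fin.cons e b', ?_⟩
  ext x
  simp only [Set.mem_inter_iff, Set.mem_ofPred_eq, Fin.forall_fin_succ, Fin.cons_zero,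
    Fin.cons_succ]
  tauto

lemma Poly.sgn {S : Set (Fin N → ℝ)} (h : Poly S) (c : Fin N → ℝ) (σ : SignType) :
    Poly (S ∩ {x | SignType.sign (ip x c) = σ}) := by
  have e1 : ∀ x : Fin N → ℝ, ∑ j, c j * x j = ip x c := fun x =>
    Finset.sum_congr rfl fun i _ => mul_comm _ _
  have e2 : ∀ x : Fin N → ℝ, ∑ j, (-c) j * x j = - ip x c := fun x => by
    rw [← e1]; simp
  rcases SignType.trichotomy σ with rfl | rfl | rfl
  · convert h.lt c 0 using 2
    ext x
    simp only [Set.mem_ofPred_eq, e1, sign_eq_neg_one_iff]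
  · convert (h.le c 0).le (-c) 0 using 1
    ext x
    simp only [Set.mem_ofPred_eq, Set.mem_inter_iff, e1, e2, sign_eq_zero_iff, and_assoc]
    refine and_congr_right fun _ => ?_
    constructor
    · intro h; constructor <;> linarith
    · rintro ⟨h1, h2⟩; linarith
  · convert h.lt (-c) 0 using 2
    ext x
    simp only [Set.mem_ofPred_eq, e2, sign_eq_one_iff]
    constructor <;> intro h <;> linarith

lemma poly_cell (F : Finset (Fin N → ℝ)) (x0 : Fin N → ℝ) : Poly (cell F x0) := by
  induction F using Finset.induction_on with
  | empty => exact ⟨0, 0, Fin.elim0, Fin.elim0, Fin.elim0, Fin.elim0, by simp [cell]⟩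
  | insert a F ha ih =>
    convert ih.sgn a (SignType.sign (ip x0 a)) using 1
    ext x
    simp only [cell, Finset.forall_mem_insert, Set.mem_inter_iff, Set.mem_ofPred_eq]
    tauto

lemma finite_cells (F : Finset (Fin N → ℝ)) : {S | ∃ x0, memX N x0 ∧ S = cell F x0}.Finite := by
  refine (Set.finite_range (fun τ : F → SignType =>
    {x : Fin N → ℝ | memX N x ∧ ∀ a : F, SignType.sign (ip x a) = τ a})).subset ?_
  rintro S ⟨x0, -, rfl⟩
  exact ⟨fun a => SignType.sign (ip x0 a), by ext x; simp [cell]⟩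

lemma cell_eq {F : Finset (Fin N → ℝ)} {x y : Fin N → ℝ} (h : x ∈ cell F y) :
    cell F x = cell F y := by
  ext w
  refine and_congr_right fun _ => forall₂_congr fun a ha => ?_
  rw [h.2 a ha]

lemma cell_mono {F G : Finset (Fin N → ℝ)} (h : F ⊆ G) (x : Fin N → ℝ) :
    cell G x ⊆ cell F x := fun _ hw => ⟨hw.1, fun a ha => hw.2 a (h ha)⟩

lemma sigz_nonneg {P : Fin M → Z → Matrix (Fin N) (Fin N) ℝ} (hP : ∀ k z i j, 0 ≤ P k z i j)
    (k : Fin M) (z : Z) {x : Fin N → ℝ} (hx : memX N x) : 0 ≤ sigz P k z x :=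
  Finset.sum_nonneg fun i _ => mul_nonneg (hx.1 i) (Finset.sum_nonneg fun j _ => hP k z i j)

lemma sigz_lam (P : Fin M → Z → Matrix (Fin N) (Fin N) ℝ) (k : Fin M) (z : Z) {x : Fin N → ℝ}
    (h : sigz P k z x ≠ 0) (a : Fin N → ℝ) :
    sigz P k z x * ip (lam P k z x) a = ip x (pull (P k z) a) := by
  unfold ip pull
  simp only [lam, Finset.mul_sum]
  rw [Finset.sum_comm]
  refine Finset.sum_congr rfl fun j _ => ?_
  rw [div_mul_eq_mul_div, mul_div_cancel₀ _ h, Finset.sum_mul]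
  exact Finset.sum_congr rfl fun i _ => by ring

lemma lam_mem {P : Fin M → Z → Matrix (Fin N) (Fin N) ℝ} (hP : ∀ k z i j, 0 ≤ P k z i j)
    (k : Fin M) (z : Z) {x : Fin N → ℝ} (hx : memX N x) (h : sigz P k z x ≠ 0) :
    memX N (lam P k z x) := by
  constructor
  · intro j
    exact div_nonneg (Finset.sum_nonneg fun i _ => mul_nonneg (hx.1 i) (hP k z i j))
      (sigz_nonneg hP k z hx)
  · have := sigz_lam P k z h (fun _ => 1)
    have h2 : ip x (pull (P k z) fun _ => 1) = sigz P k z x := by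
      simp [ip, pull, sigz]
    rw [h2] at this
    have h3 := mul_left_cancel₀ h (this.trans (mul_one _).symm)
    simpa [ip] using h3

lemma step {P : Fin M → Z → Matrix (Fin N) (Fin N) ℝ} (hP : ∀ k z i j, 0 ≤ P k z i j)
    (d : Fin M → ℤ) (p hc β : ℝ) (n : ℕ) (F : Finset (Fin N → ℝ))
    (hF : ∀ x0, memX N x0 → ∀ s, LinOn (cell F x0) (fun x => vUp P d p hc β n x s)) :
    ∃ G, F ⊆ G ∧
      ∀ x0, memX N x0 → ∀ s, LinOn (cell G x0) (fun x => vUp P d p hc β (n + 1) x s) := by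
  choose ℓ hℓ using fun y : ℝ => LinOn.Lf (S := Set.univ) P d p hc y
  beta_reduce at hℓ
  let G1 : Finset (Fin N → ℝ) :=
    Finset.univ.image (fun q : Fin M × Fin M => ℓ (d q.1) - ℓ (d q.2))
  let G2 : Finset (Fin N → ℝ) :=
    Finset.univ.image (fun q : Fin M × Z => fun i => ∑ j, P q.1 q.2 i j)
  let G3 : Finset (Fin N → ℝ) :=
    (Finset.univ ×ˢ F).image (fun q : (Fin M × Z) × (Fin N → ℝ) => pull (P q.1.1 q.1.2) q.2)
  refine ⟨F ∪ G1 ∪ G2 ∪ G3, fun a ha => by simp [ha], fun x0 hx0 s => ?_⟩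
  set G := F ∪ G1 ∪ G2 ∪ G3 with hG
  have hs : ∀ x ∈ cell G x0, sStar P d p hc x = sStar P d p hc x0 := by
    intro x hx
    unfold sStar
    congr 1
    ext t
    refine exists_congr fun m => and_congr_right fun _ => forall_congr' fun k => ?_
    have hm : ℓ (d k) - ℓ (d m) ∈ G := by
      have : ℓ (d k) - ℓ (d m) ∈ G1 := Finset.mem_image.2 ⟨(k, m), Finset.mem_univ _, rfl⟩
      simp [hG, this]
    have key : ∀ w : Fin N → ℝ, ip w (ℓ (d k) - ℓ (d m)) =
        Lf P d p hc w (d k) - Lf P d p hc w (d m) := by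
      intro w
      rw [hℓ (d k) w trivial, hℓ (d m) w trivial]
      simp [ip, mul_sub, Finset.sum_sub_distrib]
    have h := hx.2 _ hm
    rw [key, key] at h
    rw [← sub_nonneg, ← sign_nonneg_iff, h, sign_nonneg_iff, sub_nonneg]
  have hz : ∀ k z, ∀ x ∈ cell G x0,
      SignType.sign (sigz P k z x) = SignType.sign (sigz P k z x0) := by
    intro k z x hx
    have : (fun i => ∑ j, P k z i j) ∈ G2 := Finset.mem_image.2 ⟨(k, z), Finset.mem_univ _, rfl⟩
    exact hx.2 (fun i => ∑ j, P k z i j) (by simp [hG, this])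
  have main : LinOn (cell G x0) (fun x => Lf P d p hc x ((max (sStar P d p hc x0) s : ℤ) : ℝ) +
      β * ∑ k, ∑ z, (if sigz P k z x = 0 then 0
       else sigz P k z x * vUp P d p hc β n (lam P k z x) (max (sStar P d p hc x0) s - d k))) := by
    refine (LinOn.Lf P d p hc _).add (LinOn.smul _ (LinOn.sum _ fun k => LinOn.sum _ fun z => ?_))
    by_cases h0 : sigz P k z x0 = 0
    · refine LinOn.zero.congr fun x hx => ?_
      have := hz k z x hx
      rw [h0, sign_zero, sign_eq_zero_iff] at this
      simp [this]
    · have h0p : 0 < sigz P k z x0 := lt_of_le_of_ne (sigz_nonneg hP k z hx0) (Ne.symm h0)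
      obtain ⟨γ, hγ⟩ := hF _ (lam_mem hP k z hx0 h0) (max (sStar P d p hc x0) s - d k)
      refine ⟨pull (P k z) γ, fun x hx => ?_⟩
      have hxp : 0 < sigz P k z x := by
        have := hz k z x hx
        rwa [sign_pos h0p, sign_eq_one_iff] at this
      have hmem : lam P k z x ∈ cell F (lam P k z x0) := by
        refine ⟨lam_mem hP k z hx.1 hxp.ne', fun a ha => ?_⟩
        have : pull (P k z) a ∈ G3 := Finset.mem_image.2 ⟨((k, z), a), by simp [ha], rfl⟩
        have h := hx.2 (pull (P k z) a) (by simp [hG, this])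
        rw [← sigz_lam P k z hxp.ne', ← sigz_lam P k z h0, sign_mul, sign_mul, sign_pos hxp,
          sign_pos h0p, one_mul, one_mul] at h
        exact h
      beta_reduce at hγ ⊢
      rw [if_neg hxp.ne', hγ _ hmem]
      exact sigz_lam P k z hxp.ne' γ
  refine main.congr fun x hx => ?_
  simp only [vUp, hs x hx]

/-- Lemma 8.5: for each `n ≥ 1` there is a finite partition `𝒞_n` of the
belief space `X` into sets described by finitely many (strict or weak) linear inequalities,
on each element of which `v^U_n(·, s)` is linear, with `𝒞_{n+1}` refining `𝒞_n`. -/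
theorem stmt11 {N M : ℕ} {Z : Type*} [Fintype Z] [Nonempty Z]
    (hN : 1 ≤ N) (hM : 1 ≤ M)
    (d : Fin M → ℤ) (hd : StrictMono d)
    (P : Fin M → Z → Matrix (Fin N) (Fin N) ℝ)
    (hPnn : ∀ k z i j, 0 ≤ P k z i j)
    (hPst : ∀ i : Fin N, ∑ k : Fin M, ∑ z : Z, ∑ j : Fin N, P k z i j = 1)
    (p hc : ℝ) (hp : 0 < p) (hhc : 0 < hc)
    (β : ℝ) (hβ0 : 0 ≤ β) (hβ1 : β < 1) :
    ∃ C : ℕ → Finset (Set (Fin N → ℝ)),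
      ∀ n : ℕ, 1 ≤ n →
        -- pairwise disjoint
        (∀ S ∈ C n, ∀ T ∈ C n, S ≠ T → S ∩ T = ∅) ∧
        -- union is X
        (⋃₀ (↑(C n) : Set (Set (Fin N → ℝ))) = {x : Fin N → ℝ | memX N x}) ∧
        -- each element is cut out of X by finitely many strict/weak linear inequalities
        (∀ S ∈ C n, ∃ (ks kw : ℕ) (a : Fin ks → Fin N → ℝ) (b : Fin ks → ℝ)
            (a' : Fin kw → Fin N → ℝ) (b' : Fin kw → ℝ),
          S = {x : Fin N → ℝ | memX N x ∧ (∀ i, ∑ j, a i j * x j < b i) ∧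
            (∀ i, ∑ j, a' i j * x j ≤ b' i)}) ∧
        -- v^U_n(·,s) is linear on each element
        (∀ s : ℤ, ∀ S ∈ C n, ∃ γ : Fin N → ℝ, ∀ x ∈ S,
          vUp P d p hc β n x s = ∑ i, x i * γ i) ∧
        -- refinement
        (∀ S ∈ C (n + 1), ∃ T ∈ C n, S ⊆ T) := by
  have hstep := fun n F hF => step (P := P) hPnn d p hc β n F hF
  let Good : ℕ → Finset (Fin N → ℝ) → Prop := fun n F =>
    ∀ x0, memX N x0 → ∀ s, LinOn (cell F x0) (fun x => vUp P d p hc β n x s)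
  have h0 : Good 0 ∅ := fun x0 _ s => LinOn.zero.congr fun x _ => by simp [vUp]
  let f : (n : ℕ) → {F // Good n F} := fun n =>
    Nat.rec ⟨∅, h0⟩ (fun n F => ⟨(hstep n F.1 F.2).choose, (hstep n F.1 F.2).choose_spec.2⟩) n
  have hf : ∀ n, (f n).1 ⊆ (f (n + 1)).1 := fun n =>
    (hstep n (f n).1 (f n).2).choose_spec.1
  refine ⟨fun n => (finite_cells (f n).1).toFinset, fun n _ => ?_⟩
  simp only [Set.Finite.mem_toFinset, Set.Finite.coe_toFinset, Set.mem_ofPred_eq]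
  refine ⟨?_, ?_, ?_, ?_, ?_⟩
  · rintro S ⟨x, hx, rfl⟩ T ⟨y, hy, rfl⟩ hne
    by_contra hcon
    obtain ⟨w, h1, h2⟩ := Set.nonempty_iff_ne_empty.2 hcon
    exact hne ((cell_eq h1).symm.trans (cell_eq h2))
  · ext x
    constructor
    · rintro ⟨S, ⟨y, hy, rfl⟩, hx⟩
      exact hx.1
    · intro hx
      exact ⟨_, ⟨x, hx, rfl⟩, hx, fun _ _ => rfl⟩
  · rintro S ⟨x, hx, rfl⟩
    exact poly_cell _ _
  · rintro s S ⟨x, hx, rfl⟩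
    exact (f n).2 x hx s
  · rintro S ⟨x, hx, rfl⟩
    exact ⟨_, ⟨x, hx, rfl⟩, cell_mono (hf n) x⟩

end InvCtrl
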